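/- Let A, B, C, D be unit vectors in ℝ³ with A ≠ B and C ≠ D, whose pairwise spherical distances d(x,y) = arccos⟨x,y⟩ are all strictly less than π/2. Then |⟨A,C⟩ + ⟨B,D⟩ − ⟨A,D⟩ − ⟨B,C⟩| ≤ d(A,B) · d(C,D); equivalently, |h(A,B;C,D)| ≤ 1. -/

import Mathlib

open Real RealInnerProductSpace

/-- The spherical distance between two (unit) vectors of Euclidean `ℝ³`. -/
noncomputable def sphDist (x y : EuclideanSpace ℝ (Fin 3)) : ℝ :=
  Real.arccos ⟪x, y⟫

/-- The quadrilateral function `h(A,B;C,D)` on the unit sphere. -/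
noncomputable def quadH (A B C D : EuclideanSpace ℝ (Fin 3)) : ℝ :=
  (Real.cos (sphDist A C) + Real.cos (sphDist B D) - Real.cos (sphDist A D)
      - Real.cos (sphDist B C)) / (sphDist A B * sphDist C D)

theorem cos_sphDist (x y : EuclideanSpace ℝ (Fin 3)) (hx : ‖x‖ = 1) (hy : ‖y‖ = 1) :
    Real.cos (sphDist x y) = ⟪x, y⟫ := by
  have h := abs_le.1 (abs_real_inner_le_norm x y)
  rw [hx, hy, mul_one] at h
  exact Real.cos_arccos h.1 h.2

theorem norm_sub_le_sphDist (x y : EuclideanSpace ℝ (Fin 3)) (hx : ‖x‖ = 1) (hy : ‖y‖ = 1) :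
    ‖x - y‖ ≤ sphDist x y := by
  have hc := cos_sphDist x y hx hy
  have h1 := Real.one_sub_sq_div_two_le_cos (x := sphDist x y)
  have h2 := norm_sub_sq_real x y
  have h0 : 0 ≤ sphDist x y := Real.arccos_nonneg _
  rw [hx, hy] at h2
  refine abs_le_of_sq_le_sq' ?_ h0 |>.2
  linarith

/-- Lemma 3.8: for four points of the unit sphere with pairwise spherical distances less
than `π/2`, `|⟨A,C⟩ + ⟨B,D⟩ − ⟨A,D⟩ − ⟨B,C⟩| ≤ d(A,B)·d(C,D)`; equivalently
`|h(A,B;C,D)| ≤ 1`. -/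
theorem sph_quadH_bound (A B C D : EuclideanSpace ℝ (Fin 3))
    (hA : ‖A‖ = 1) (hB : ‖B‖ = 1) (hC : ‖C‖ = 1) (hD : ‖D‖ = 1)
    (hAB : A ≠ B) (hCD : C ≠ D)
    (hdAB : sphDist A B < π / 2) (hdAC : sphDist A C < π / 2)
    (hdAD : sphDist A D < π / 2) (hdBC : sphDist B C < π / 2)
    (hdBD : sphDist B D < π / 2) (hdCD : sphDist C D < π / 2) :
    |⟪A, C⟫ + ⟪B, D⟫ - ⟪A, D⟫ - ⟪B, C⟫| ≤ sphDist A B * sphDist C D ∧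
      |quadH A B C D| ≤ 1 := by
  have key : |⟪A, C⟫ + ⟪B, D⟫ - ⟪A, D⟫ - ⟪B, C⟫| ≤ sphDist A B * sphDist C D := by
    have e : ⟪A, C⟫ + ⟪B, D⟫ - ⟪A, D⟫ - ⟪B, C⟫ = ⟪A - B, C - D⟫ := by
      simp only [inner_sub_left, inner_sub_right]
      ring
    rw [e]
    refine (abs_real_inner_le_norm _ _).trans ?_
    exact mul_le_mul (norm_sub_le_sphDist A B hA hB) (norm_sub_le_sphDist C D hC hD)
      (norm_nonneg _) (Real.arccos_nonneg _)
  refine ⟨key, ?_⟩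
  have h0 : 0 ≤ sphDist A B * sphDist C D :=
    mul_nonneg (Real.arccos_nonneg _) (Real.arccos_nonneg _)
  unfold quadH
  rw [cos_sphDist A C hA hC, cos_sphDist B D hB hD, cos_sphDist A D hA hD,
    cos_sphDist B C hB hC, abs_div, abs_of_nonneg h0]
  exact div_le_one_of_le₀ key h0
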